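/- A finite simple graph G on n vertices is symmetric with respect to graph entropy if and only if χ_f(G) = n/α(G), where α(G) is the independence number of G. -/

import Mathlib

open Finset

/-- `I` is an independent set of the graph `G`. -/
def IsIndepSet {V : Type*} (G : SimpleGraph V) (I : Finset V) : Prop :=
  ∀ u ∈ I, ∀ w ∈ I, ¬ G.Adj u w

/-- The characteristic vector (in `ℝ^V`) of a finite set of vertices. -/
def charVec {V : Type*} [DecidableEq V] (I : Finset V) : V → ℝ :=
  fun v => if v ∈ I then 1 else 0

/-- The vertex packing polytope `VP(G)`: the convex hull of the characteristic
vectors of the independent sets of `G`. -/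
def vertexPacking {V : Type*} [Fintype V] [DecidableEq V] (G : SimpleGraph V) : Set (V → ℝ) :=
  convexHull ℝ {x | ∃ I : Finset V, IsIndepSet G I ∧ x = charVec I}

/-- `P` is a probability distribution on the (finite) vertex set `V`. -/
def IsProbDist {V : Type*} [Fintype V] (P : V → ℝ) : Prop :=
  (∀ v, 0 ≤ P v) ∧ ∑ v, P v = 1

/-- The entropy of the graph `G` with respect to `P`:
`H(G,P) = min_{a ∈ VP(G)} ∑_v p_v · log₂(1/a_v)`, where (by the convention
`0 · log₂(1/0) = 0`) coordinates with `p_v = 0` are irrelevant and the minimum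
is never achieved with `a_v = 0` at a coordinate with `p_v > 0`; accordingly the
minimization is over points of `VP(G)` that are positive on the support of `P`. -/
noncomputable def graphEntropy {V : Type*} [Fintype V] [DecidableEq V]
    (G : SimpleGraph V) (P : V → ℝ) : ℝ :=
  sInf { x | ∃ a ∈ vertexPacking G, (∀ v, 0 < P v → 0 < a v) ∧
      x = ∑ v, P v * Real.logb 2 (1 / a v) }

/-- The fractional chromatic number of `G`: the minimum of `∑_I w_I` over
nonnegative weight functions on the independent sets of `G` such that
`∑_{I ∋ v} w_I ≥ 1` for every vertex `v`. -/
noncomputable def fracChromatic {V : Type*} [Fintype V] [DecidableEq V]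
    (G : SimpleGraph V) : ℝ :=
  sInf { x | ∃ w : Finset V → ℝ, (∀ I, 0 ≤ w I) ∧ (∀ I, w I ≠ 0 → IsIndepSet G I) ∧
      (∀ v : V, 1 ≤ ∑ I ∈ Finset.univ.filter (fun I : Finset V => v ∈ I), w I) ∧
      x = ∑ I : Finset V, w I }

/-- The independence number `α(G)`. -/
noncomputable def indepNum {V : Type*} [Fintype V] (G : SimpleGraph V) : ℕ :=
  sSup {n | ∃ I : Finset V, IsIndepSet G I ∧ I.card = n}

/-- `I` is a maximum weighted independent set of `G` with respect to `P`. -/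
def IsMaxWeightIndep {V : Type*} [Fintype V] (G : SimpleGraph V) (P : V → ℝ)
    (I : Finset V) : Prop :=
  IsIndepSet G I ∧ ∀ J : Finset V, IsIndepSet G J → ∑ v ∈ J, P v ≤ ∑ v ∈ I, P v

/-- A multiset `S` of (independent) sets uniformly covers `W` if every vertex of `W`
belongs to exactly the same (positive) number of members of `S`, counted with
multiplicity. -/
def UniformOver {V : Type*} [DecidableEq V] (S : Multiset (Finset V)) (W : Set V) : Prop :=
  ∃ c : ℕ, 0 < c ∧ ∀ v ∈ W, (S.filter (fun I => v ∈ I)).card = c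

/-- `G` is symmetric with respect to graph entropy: the uniform distribution
maximizes `H(G, ·)`. -/
def EntropySymmetric {V : Type*} [Fintype V] [DecidableEq V] (G : SimpleGraph V) : Prop :=
  ∀ P : V → ℝ, IsProbDist P →
    graphEntropy G P ≤ graphEntropy G (fun _ => (1 : ℝ) / Fintype.card V)

/-! ### The independence number -/

theorem isIndepSet_singleton {V : Type*} (G : SimpleGraph V) (v : V) : IsIndepSet G {v} := by
  simp [IsIndepSet]

section IndepNum

variable {V : Type*} [Fintype V] (G : SimpleGraph V)

theorem bddAbove_card_isIndepSet : BddAbove {n | ∃ I : Finset V, IsIndepSet G I ∧ I.card = n} := by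
  refine ⟨Fintype.card V, ?_⟩
  rintro _ ⟨I, -, rfl⟩
  exact I.card_le_univ

variable {G} in
theorem IsIndepSet.card_le_indepNum {I : Finset V} (hI : IsIndepSet G I) :
    I.card ≤ indepNum G :=
  le_csSup (bddAbove_card_isIndepSet G) ⟨I, hI, rfl⟩

theorem exists_isIndepSet_card_eq_indepNum :
    ∃ I : Finset V, IsIndepSet G I ∧ I.card = indepNum G :=
  Nat.sSup_mem (s := {n | ∃ I : Finset V, IsIndepSet G I ∧ I.card = n})
    ⟨0, ∅, by simp [IsIndepSet], rfl⟩ (bddAbove_card_isIndepSet G)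

theorem indepNum_pos [Nonempty V] : 0 < indepNum G := by
  obtain ⟨v⟩ := ‹Nonempty V›
  exact Nat.lt_of_lt_of_le (by simp) (isIndepSet_singleton G v).card_le_indepNum

end IndepNum

theorem isProbDist_uniform {V : Type*} [Fintype V] [Nonempty V] :
    IsProbDist (fun _ : V => (1 : ℝ) / Fintype.card V) :=
  ⟨fun _ => by positivity, by simp⟩

section Packing

variable {V : Type*} [Fintype V] [DecidableEq V] {G : SimpleGraph V}

/-! ### The vertex packing polytope -/

theorem charVec_mem_vertexPacking {I : Finset V} (hI : IsIndepSet G I) :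
    charVec I ∈ vertexPacking G :=
  subset_convexHull ℝ _ ⟨I, hI, rfl⟩

theorem convex_vertexPacking : Convex ℝ (vertexPacking G) :=
  convex_convexHull ℝ _

theorem isCompact_vertexPacking : IsCompact (vertexPacking G) := by
  refine Set.Finite.isCompact_convexHull (𝕜 := ℝ) ?_
  refine (Set.finite_range (charVec : Finset V → V → ℝ)).subset ?_
  rintro _ ⟨I, -, rfl⟩
  exact ⟨I, rfl⟩

theorem sum_mul_charVec (p : V → ℝ) (I : Finset V) :
    ∑ v, p v * charVec I v = ∑ v ∈ I, p v := by
  simp [charVec]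

/-- A linear inequality holds on the vertex packing polytope once it holds for independent sets. -/
theorem sum_mul_le_of_mem_vertexPacking {p : V → ℝ} {r : ℝ}
    (h : ∀ I, IsIndepSet G I → ∑ v ∈ I, p v ≤ r) {a : V → ℝ} (ha : a ∈ vertexPacking G) :
    ∑ v, p v * a v ≤ r := by
  have hconv : Convex ℝ {x : V → ℝ | ∑ v, p v * x v ≤ r} := by
    refine convex_halfSpace_le ⟨fun x y => ?_, fun c x => ?_⟩ r
    · simp [mul_add, sum_add_distrib]
    · simp only [Pi.smul_apply, smul_eq_mul, mul_sum]
      exact sum_congr rfl fun v _ => by ring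
  refine convexHull_min ?_ hconv ha
  rintro _ ⟨I, hI, rfl⟩
  simpa only [Set.mem_ofPred_eq, sum_mul_charVec] using h I hI

theorem sum_le_indepNum {a : V → ℝ} (ha : a ∈ vertexPacking G) :
    ∑ v, a v ≤ indepNum G := by
  have := sum_mul_le_of_mem_vertexPacking (p := fun _ => 1) (r := indepNum G)
    (fun I hI => by simpa using hI.card_le_indepNum) ha
  simpa using this

theorem le_one_of_mem_vertexPacking {a : V → ℝ} (ha : a ∈ vertexPacking G) (v : V) :
    a v ≤ 1 := by
  have := sum_mul_le_of_mem_vertexPacking (p := Pi.single v 1) (r := 1)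
    (fun I _ => by
      simp only [Pi.single_apply, sum_ite_eq']
      split_ifs <;> norm_num) ha
  simpa [Pi.single_apply] using this

/-- Points of the vertex packing polytope are convex combinations of independent sets. -/
theorem exists_weights_of_mem_vertexPacking {a : V → ℝ} (ha : a ∈ vertexPacking G) :
    ∃ w : Finset V → ℝ, (∀ I, 0 ≤ w I) ∧ (∀ I, w I ≠ 0 → IsIndepSet G I) ∧ ∑ I, w I = 1 ∧
      ∀ v, a v = ∑ I with v ∈ I, w I := by
  have hconv : Convex ℝ {a : V → ℝ | ∃ w : Finset V → ℝ, (∀ I, 0 ≤ w I) ∧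
      (∀ I, w I ≠ 0 → IsIndepSet G I) ∧ ∑ I, w I = 1 ∧ ∀ v, a v = ∑ I with v ∈ I, w I} := by
    rintro x ⟨w, hw0, hwi, hw1, hwx⟩ y ⟨u, hu0, hui, hu1, huy⟩ s t hs ht hst
    refine ⟨fun I => s * w I + t * u I, fun I => ?_, fun I hI => ?_, ?_, fun v => ?_⟩
    · have := hw0 I
      have := hu0 I
      positivity
    · by_contra hn
      have h1 : w I = 0 := by_contra fun h => hn (hwi I h)
      have h2 : u I = 0 := by_contra fun h => hn (hui I h)
      simp [h1, h2] at hI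
    · rw [sum_add_distrib, ← mul_sum, ← mul_sum, hw1, hu1]
      linarith
    · simp [sum_add_distrib, ← mul_sum, hwx, huy]
  refine convexHull_min ?_ hconv ha
  rintro _ ⟨I, hI, rfl⟩
  refine ⟨Pi.single I 1, fun J => ?_, fun J hJ => ?_, by simp, fun v => ?_⟩
  · by_cases h : J = I <;> simp [h]
  · by_cases h : J = I
    · exact h ▸ hI
    · simp [h] at hJ
  · simp [charVec]

/-- Normalizing a fractional colouring gives a point of the vertex packing polytope. -/
theorem exists_mem_vertexPacking_of_cover {w : Finset V → ℝ} (hw0 : ∀ I, 0 ≤ w I)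
    (hwi : ∀ I, w I ≠ 0 → IsIndepSet G I) (hcov : ∀ v, 1 ≤ ∑ I with v ∈ I, w I)
    (hpos : 0 < ∑ I, w I) :
    ∃ b ∈ vertexPacking G, ∀ v, 1 / ∑ I, w I ≤ b v := by
  classical
  set x := ∑ I, w I
  have hsum : ∀ f : Finset V → ℝ,
      ∑ I with IsIndepSet G I, w I / x * f I = ∑ I, w I / x * f I := by
    intro f
    refine sum_filter_of_ne fun I _ hI => hwi I ?_
    rintro h
    simp [h] at hI
  refine ⟨∑ I with IsIndepSet G I, (w I / x) • charVec I, ?_, fun v => ?_⟩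
  · refine convex_vertexPacking.sum_mem (fun I _ => div_nonneg (hw0 I) hpos.le) ?_ ?_
    · have := hsum fun _ => 1
      simp only [mul_one] at this
      rw [this, ← sum_div, div_self hpos.ne']
    · intro I hI
      exact charVec_mem_vertexPacking (by simpa using hI)
  · simp only [Finset.sum_apply, Pi.smul_apply, smul_eq_mul]
    rw [hsum fun I => charVec I v]
    have : ∑ I, w I / x * charVec I v = (∑ I with v ∈ I, w I) / x := by
      rw [sum_div, sum_filter]
      exact sum_congr rfl fun I _ => by simp [charVec]
    rw [this]
    exact div_le_div_of_nonneg_right (hcov v) hpos.le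

/-! ### The fractional chromatic number -/

theorem fracChromatic_le {w : Finset V → ℝ} (hw0 : ∀ I, 0 ≤ w I)
    (hwi : ∀ I, w I ≠ 0 → IsIndepSet G I) (hcov : ∀ v, 1 ≤ ∑ I with v ∈ I, w I) :
    fracChromatic G ≤ ∑ I, w I := by
  refine csInf_le ⟨0, ?_⟩ ⟨w, hw0, hwi, hcov, rfl⟩
  rintro _ ⟨u, hu, -, -, rfl⟩
  exact sum_nonneg fun I _ => hu I

theorem fracChromatic_le_one_div {b : V → ℝ} (hb : b ∈ vertexPacking G) {m : ℝ} (hm : 0 < m)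
    (hmb : ∀ v, m ≤ b v) : fracChromatic G ≤ 1 / m := by
  obtain ⟨w, hw0, hwi, hw1, hwb⟩ := exists_weights_of_mem_vertexPacking hb
  have := fracChromatic_le (G := G) (w := fun I => w I / m)
    (fun I => div_nonneg (hw0 I) hm.le) (fun I hI => hwi I fun h => hI (by simp [h]))
    (fun v => by rw [← sum_div, ← hwb v, le_div_iff₀ hm, one_mul]; exact hmb v)
  rwa [← sum_div, hw1] at this

theorem le_fracChromatic {r : ℝ} (h : ∀ w : Finset V → ℝ, (∀ I, 0 ≤ w I) →
    (∀ I, w I ≠ 0 → IsIndepSet G I) → (∀ v, 1 ≤ ∑ I with v ∈ I, w I) → r ≤ ∑ I, w I) :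
    r ≤ fracChromatic G := by
  refine le_csInf ⟨_, fun I => if I.card = 1 then 1 else 0, fun I => ?_, fun I hI => ?_,
    fun v => ?_, rfl⟩ ?_
  · dsimp only
    split_ifs <;> norm_num
  · have hc : I.card = 1 := by
      by_contra hc
      simp [hc] at hI
    obtain ⟨v, rfl⟩ := card_eq_one.mp hc
    exact isIndepSet_singleton G v
  · refine le_trans (by simp) (single_le_sum 
      (f := fun I : Finset V => if I.card = 1 then (1 : ℝ) else 0) (fun I _ => ?_)
      (mem_filter.mpr ⟨mem_univ {v}, mem_singleton_self v⟩))
    split_ifs <;> norm_num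
  · rintro _ ⟨w, hw0, hwi, hcov, rfl⟩
    exact h w hw0 hwi hcov

theorem card_le_indepNum_mul_sum {w : Finset V → ℝ} (hw0 : ∀ I, 0 ≤ w I)
    (hwi : ∀ I, w I ≠ 0 → IsIndepSet G I) (hcov : ∀ v, 1 ≤ ∑ I with v ∈ I, w I) :
    (Fintype.card V : ℝ) ≤ indepNum G * ∑ I, w I := by
  calc (Fintype.card V : ℝ) = ∑ _v : V, (1 : ℝ) := by simp
    _ ≤ ∑ v, ∑ I with v ∈ I, w I := sum_le_sum fun v _ => hcov v
    _ = ∑ I, (I.card : ℝ) * w I := by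
        simp only [sum_filter]
        rw [sum_comm]
        exact sum_congr rfl fun I _ => by simp
    _ ≤ ∑ I, (indepNum G : ℝ) * w I := by
        refine sum_le_sum fun I _ => ?_
        by_cases h : w I = 0
        · simp [h]
        · exact mul_le_mul_of_nonneg_right (by exact_mod_cast (hwi I h).card_le_indepNum) (hw0 I)
    _ = indepNum G * ∑ I, w I := by rw [mul_sum]

theorem card_div_indepNum_le_fracChromatic [Nonempty V] :
    (Fintype.card V : ℝ) / indepNum G ≤ fracChromatic G := by
  refine le_fracChromatic fun w hw0 hwi hcov => ?_
  rw [div_le_iff₀' (by exact_mod_cast indepNum_pos G)]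
  exact card_le_indepNum_mul_sum hw0 hwi hcov

/-! ### Graph entropy -/

theorem exists_pos_mem_vertexPacking [Nonempty V] : ∃ a ∈ vertexPacking G, ∀ v, 0 < a v := by
  have hn : (0 : ℝ) < Fintype.card V := by exact_mod_cast Fintype.card_pos
  refine ⟨∑ v : V, ((1 : ℝ) / Fintype.card V) • charVec {v}, ?_, fun u => ?_⟩
  · exact convex_vertexPacking.sum_mem (fun _ _ => by positivity) (by simp)
      fun v _ => charVec_mem_vertexPacking (isIndepSet_singleton G v)
  · simpa [charVec] using hn

theorem graphEntropy_le {P a : V → ℝ} (hP : ∀ v, 0 ≤ P v) (ha : a ∈ vertexPacking G)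
    (hpos : ∀ v, 0 < P v → 0 < a v) :
    graphEntropy G P ≤ ∑ v, P v * Real.logb 2 (1 / a v) := by
  refine csInf_le ⟨0, ?_⟩ ⟨a, ha, hpos, rfl⟩
  rintro _ ⟨c, hc, hcpos, rfl⟩
  refine sum_nonneg fun v _ => ?_
  rcases (hP v).eq_or_lt with h | h
  · simp [← h]
  · refine mul_nonneg h.le (Real.logb_nonneg one_lt_two ?_)
    rw [le_div_iff₀ (hcpos v h), one_mul]
    exact le_one_of_mem_vertexPacking hc v

theorem graphEntropy_le_logb_of_le {P b : V → ℝ} (hP : IsProbDist P) (hb : b ∈ vertexPacking G)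
    {m : ℝ} (hm : 0 < m) (hmb : ∀ v, m ≤ b v) : graphEntropy G P ≤ Real.logb 2 (1 / m) := by
  calc graphEntropy G P ≤ ∑ v, P v * Real.logb 2 (1 / b v) :=
        graphEntropy_le hP.1 hb fun v _ => hm.trans_le (hmb v)
    _ ≤ ∑ v, P v * Real.logb 2 (1 / m) := by
        refine sum_le_sum fun v _ => mul_le_mul_of_nonneg_left ?_ (hP.1 v)
        have := hm.trans_le (hmb v)
        exact Real.logb_le_logb_of_le one_lt_two (by positivity)
          (one_div_le_one_div_of_le hm (hmb v))
    _ = Real.logb 2 (1 / m) := by rw [← sum_mul, hP.2, one_mul]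

/-- Jensen's inequality: a linear bound on the vertex packing polytope bounds the entropy. -/
theorem logb_le_graphEntropy [Nonempty V] {P : V → ℝ} (hP : IsProbDist P) {r : ℝ} (hr : 0 < r)
    (h : ∀ a ∈ vertexPacking G, ∑ v, P v * a v ≤ r) :
    Real.logb 2 (1 / r) ≤ graphEntropy G P := by
  obtain ⟨a₀, ha₀, hpos₀⟩ := exists_pos_mem_vertexPacking (G := G)
  refine le_csInf ⟨_, a₀, ha₀, fun v _ => hpos₀ v, rfl⟩ ?_
  rintro _ ⟨a, ha, hpos, rfl⟩
  have key : ∑ v, P v * (Real.log (a v) - Real.log r) ≤ 0 := by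
    calc ∑ v, P v * (Real.log (a v) - Real.log r) ≤ ∑ v, P v * (a v / r - 1) := by
          refine sum_le_sum fun v _ => ?_
          rcases (hP.1 v).eq_or_lt with h0 | h0
          · simp [← h0]
          · rw [← Real.log_div (hpos v h0).ne' hr.ne']
            exact mul_le_mul_of_nonneg_left
              (Real.log_le_sub_one_of_pos (div_pos (hpos v h0) hr)) h0.le
      _ = (∑ v, P v * a v) / r - 1 := by
          simp only [mul_sub, sum_sub_distrib, mul_one, hP.2, sum_div, mul_div_assoc]
      _ ≤ 0 := by
          rw [sub_nonpos, div_le_one hr]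
          exact h a ha
  simp only [mul_sub, sum_sub_distrib, ← sum_mul, hP.2, one_mul] at key
  simp only [one_div, Real.logb_inv, mul_neg, sum_neg_distrib, neg_le_neg_iff]
  simp only [Real.logb, ← mul_div_assoc, ← sum_div]
  exact div_le_div_of_nonneg_right (by linarith) (Real.log_pos one_lt_two).le

/-! ### The maximin point of the vertex packing polytope -/

theorem exists_maximin [Nonempty V] : ∃ b ∈ vertexPacking G, ∃ m : ℝ, 0 < m ∧ (∀ v, m ≤ b v) ∧
    ∀ a ∈ vertexPacking G, ∃ v, a v ≤ m := by
  obtain ⟨a₀, ha₀, hpos₀⟩ := exists_pos_mem_vertexPacking (G := G)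
  have hcont : Continuous fun a : V → ℝ => univ.inf' univ_nonempty fun v => a v :=
    Continuous.finset_inf'_apply _ fun v _ => continuous_apply v
  obtain ⟨b, hb, hmax⟩ := isCompact_vertexPacking.exists_isMaxOn ⟨a₀, ha₀⟩ hcont.continuousOn
  refine ⟨b, hb, univ.inf' univ_nonempty fun v => b v, ?_,
    fun v => inf'_le _ (mem_univ v), fun a ha => ?_⟩
  · refine lt_of_lt_of_le ?_ (hmax ha₀)
    simpa using hpos₀
  · obtain ⟨v, -, hv⟩ := exists_mem_eq_inf' univ_nonempty fun v => a v
    exact ⟨v, hv ▸ hmax ha⟩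

/-- Minimax: a probability distribution certifying the maximin value. -/
theorem exists_isProbDist_sum_mul_le [Nonempty V] {m : ℝ}
    (h : ∀ a ∈ vertexPacking G, ∃ v, a v ≤ m) :
    ∃ P : V → ℝ, IsProbDist P ∧ ∀ a ∈ vertexPacking G, ∑ v, P v * a v ≤ m := by
  have hopen : IsOpen (Set.univ.pi fun _ : V => Set.Ioi m) :=
    isOpen_set_pi Set.finite_univ fun _ _ => isOpen_Ioi
  have hconv : Convex ℝ (Set.univ.pi fun _ : V => Set.Ioi m) :=
    convex_pi fun _ _ => convex_Ioi m
  have hdisj : Disjoint (vertexPacking G) (Set.univ.pi fun _ : V => Set.Ioi m) := by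
    rw [Set.disjoint_left]
    intro a ha ha'
    obtain ⟨v, hv⟩ := h a ha
    exact absurd (ha' v (Set.mem_univ v)) (not_lt.mpr hv)
  obtain ⟨f, u, hfu, huf⟩ :=
    geometric_hahn_banach_open hconv hopen convex_vertexPacking hdisj.symm
  set y : V → ℝ := fun v => -f (Pi.single v 1) with hy
  have hf : ∀ x : V → ℝ, -f x = ∑ v, y v * x v := by
    intro x
    conv_lhs => rw [pi_eq_sum_univ' x]
    simp [hy, mul_comm]
  have hlow : ∀ x : V → ℝ, (∀ v, m < x v) → -u < ∑ v, y v * x v := fun x hx => by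
    rw [← hf]
    exact neg_lt_neg (hfu x fun v _ => hx v)
  have hup : ∀ a ∈ vertexPacking G, ∑ v, y v * a v ≤ -u := fun a ha => by
    rw [← hf]
    exact neg_le_neg (huf a ha)
  have hy0 : ∀ v, 0 ≤ y v := by
    intro v
    by_contra! hv
    set S := ∑ w, y w * (m + 1) with hS
    set T := max 0 ((S + u) / (-y v)) with hT
    have h1 := hlow (fun w => (m + 1) + T * Pi.single (M := fun _ => ℝ) v 1 w) fun w => by
      have : 0 ≤ T * Pi.single (M := fun _ => ℝ) v 1 w := by
        refine mul_nonneg (le_max_left _ _) ?_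
        by_cases hw : w = v <;> simp [hw]
      linarith
    have h2 : ∑ w, y w * ((m + 1) + T * Pi.single (M := fun _ => ℝ) v 1 w) = S + y v * T := by
      simp [mul_add, sum_add_distrib, hS, Pi.single_apply]
    rw [h2] at h1
    have h3 : (S + u) / (-y v) ≤ T := le_max_right _ _
    rw [div_le_iff₀ (by linarith)] at h3
    linarith
  obtain ⟨a₀, ha₀, -⟩ := exists_pos_mem_vertexPacking (G := G)
  have hYpos : 0 < ∑ v, y v := by
    refine (sum_nonneg fun v _ => hy0 v).lt_of_ne' fun h0 => ?_
    have hz : ∀ v, y v = 0 := fun v =>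
      (sum_eq_zero_iff_of_nonneg fun v _ => hy0 v).mp h0 v (mem_univ v)
    have h1 := hlow (fun _ => m + 1) fun _ => lt_add_one m
    have h2 := hup a₀ ha₀
    simp only [hz, zero_mul, sum_const_zero] at h1 h2
    linarith
  have hu : -u ≤ (∑ v, y v) * m := by
    refine le_of_forall_pos_le_add fun ε hε => ?_
    have := hlow (fun _ => m + ε / ∑ v, y v) fun _ => lt_add_of_pos_right m (by positivity)
    rw [← sum_mul, mul_add, mul_div_cancel₀ _ hYpos.ne'] at this
    exact this.le
  refine ⟨fun v => y v / ∑ v, y v, ⟨fun v => div_nonneg (hy0 v) hYpos.le, ?_⟩, fun a ha => ?_⟩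
  · rw [← sum_div, div_self hYpos.ne']
  · simp only [div_mul_eq_mul_div]
    rw [← sum_div, div_le_iff₀' hYpos]
    exact (hup a ha).trans hu

/-- First-order optimality: if `∑ log (1 + s d_v) ≤ 0` for small positive `s` then `∑ d_v ≤ 0`. -/
theorem sum_nonpos_of_sum_log_nonpos {ι : Type*} (t : Finset ι) (d : ι → ℝ)
    (hd : ∀ i ∈ t, -1 ≤ d i)
    (h : ∀ s ∈ Set.Ioo (0 : ℝ) 1, ∑ i ∈ t, Real.log (1 + s * d i) ≤ 0) : ∑ i ∈ t, d i ≤ 0 := by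
  have hcont : ContinuousAt (fun s : ℝ => ∑ i ∈ t, d i / (1 + s * d i)) 0 := by
    refine tendsto_finsetSum _ fun i _ => ?_
    exact ContinuousAt.div (by fun_prop) (by fun_prop) (by simp)
  have hlim : Filter.Tendsto (fun s : ℝ => ∑ i ∈ t, d i / (1 + s * d i))
      (nhdsWithin 0 (Set.Ioi 0)) (nhds (∑ i ∈ t, d i)) := by
    simpa [ContinuousAt] using hcont.tendsto.mono_left nhdsWithin_le_nhds
  refine le_of_tendsto hlim ?_
  filter_upwards [Ioo_mem_nhdsGT (zero_lt_one' ℝ)] with s hs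
  have hs0 := hs.1
  refine nonpos_of_mul_nonpos_right (a := s) ?_ hs0
  refine le_trans ?_ (h s hs)
  rw [mul_sum]
  refine sum_le_sum fun i hi => ?_
  have hpos : 0 < 1 + s * d i := by nlinarith [hs.2, hd i hi]
  have := Real.one_sub_inv_le_log_of_pos hpos
  have heq : s * (d i / (1 + s * d i)) = 1 - (1 + s * d i)⁻¹ := by
    rw [eq_sub_iff_add_eq, mul_div_assoc', ← one_div, ← add_div, add_comm, div_self hpos.ne']
  rwa [heq]

theorem indepNum_le_card_mul [Nonempty V] {b : V → ℝ} (hb : b ∈ vertexPacking G) {m : ℝ}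
    (hm : 0 < m) (hmb : ∀ v, m ≤ b v)
    (h : Real.logb 2 (1 / m) ≤ graphEntropy G (fun _ => (1 : ℝ) / Fintype.card V)) :
    (indepNum G : ℝ) ≤ Fintype.card V * m := by
  have hn : (0 : ℝ) < Fintype.card V := by exact_mod_cast Fintype.card_pos
  obtain ⟨I, hI, hcard⟩ := exists_isIndepSet_card_eq_indepNum G
  have hI0 : ∀ v, 0 ≤ charVec I v := fun v => by
    unfold charVec
    split_ifs <;> norm_num
  have key : ∑ v, (charVec I v / m - 1) ≤ 0 := by
    refine sum_nonpos_of_sum_log_nonpos _ _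
      (fun v _ => by linarith [div_nonneg (hI0 v) hm.le]) fun s hs => ?_
    have hs0 := hs.1
    have hs1 : 0 < 1 - s := sub_pos.mpr hs.2
    have hc : (1 - s) • b + s • charVec I ∈ vertexPacking G :=
      convex_vertexPacking hb (charVec_mem_vertexPacking hI) hs1.le hs0.le (by ring)
    have hbpos : ∀ v, 0 < b v := fun v => hm.trans_le (hmb v)
    have hcpos : ∀ v, 0 < ((1 - s) • b + s • charVec I) v := fun v => by
      have := hbpos v
      have := hI0 v
      simp only [Pi.add_apply, Pi.smul_apply, smul_eq_mul]
      positivity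
    have hH := h.trans (graphEntropy_le isProbDist_uniform.1 hc fun v _ => hcpos v)
    rw [← mul_sum, one_div_mul_eq_div, le_div_iff₀ hn] at hH
    simp only [one_div, Real.logb_inv, sum_neg_distrib] at hH
    simp only [Real.logb, ← sum_div] at hH
    have hlog2 : 0 < Real.log 2 := Real.log_pos one_lt_two
    have hH' : ∑ v, Real.log (((1 - s) • b + s • charVec I) v) ≤ Fintype.card V * Real.log m := by
      have : (∑ v, Real.log (((1 - s) • b + s • charVec I) v)) / Real.log 2 ≤
          (Fintype.card V * Real.log m) / Real.log 2 := by
        rw [mul_div_assoc]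
        linarith
      exact (div_le_div_iff_of_pos_right hlog2).mp this
    calc ∑ v, Real.log (1 + s * (charVec I v / m - 1))
        ≤ ∑ v, (Real.log (((1 - s) • b + s • charVec I) v) - Real.log m) := by
          refine sum_le_sum fun v _ => ?_
          rw [← Real.log_div (hcpos v).ne' hm.ne']
          have heq : 1 + s * (charVec I v / m - 1) = ((1 - s) * m + s * charVec I v) / m := by
            field_simp
            ring
          have := hI0 v
          rw [heq]
          refine Real.log_le_log (by positivity) (div_le_div_of_nonneg_right ?_ hm.le)
          simp only [Pi.add_apply, Pi.smul_apply, smul_eq_mul]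
          gcongr
          exact hmb v
      _ ≤ 0 := by simpa [sum_sub_distrib] using hH'
  have hsum : ∑ v, charVec I v = indepNum G := by
    rw [← hcard]
    simp [charVec]
  rw [sum_sub_distrib, ← sum_div, hsum] at key
  simp only [sum_const, card_univ, nsmul_eq_mul, mul_one, sub_nonpos] at key
  rwa [div_le_iff₀ hm] at key

end Packing

/-- A graph `G` on `n` vertices is symmetric with respect to graph entropy iff
`χ_f(G) = n / α(G)`. -/
theorem entropySymmetric_iff_fracChromatic_eq_card_div_indepNum
    {V : Type*} [Fintype V] [DecidableEq V] [Nonempty V] (G : SimpleGraph V) :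
    EntropySymmetric G ↔
      fracChromatic G = (Fintype.card V : ℝ) / (indepNum G : ℝ) := by
  have hn : (0 : ℝ) < Fintype.card V := by exact_mod_cast Fintype.card_pos
  have hα : (0 : ℝ) < indepNum G := by exact_mod_cast indepNum_pos G
  constructor
  · intro hsym
    obtain ⟨b, hb, m, hm, hmb, hmax⟩ := exists_maximin (G := G)
    obtain ⟨P, hP, hPm⟩ := exists_isProbDist_sum_mul_le hmax
    have hαm := indepNum_le_card_mul hb hm hmb ((logb_le_graphEntropy hP hm hPm).trans (hsym P hP))
    refine le_antisymm ((fracChromatic_le_one_div hb hm hmb).trans ?_)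
      card_div_indepNum_le_fracChromatic
    rwa [div_le_div_iff₀ hm hα, one_mul]
  · intro hχ P hP
    have hupper : (2 : ℝ) ^ graphEntropy G P ≤ Fintype.card V / indepNum G := by
      rw [← hχ]
      refine le_fracChromatic fun w hw0 hwi hcov => ?_
      have hpos : 0 < ∑ I, w I :=
        pos_of_mul_pos_right (hn.trans_le (card_le_indepNum_mul_sum hw0 hwi hcov)) hα.le
      obtain ⟨b, hb, hwb⟩ := exists_mem_vertexPacking_of_cover hw0 hwi hcov hpos
      have := graphEntropy_le_logb_of_le hP hb (one_div_pos.mpr hpos) hwb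
      rwa [one_div_one_div, Real.le_logb_iff_rpow_le one_lt_two hpos] at this
    rw [← Real.le_logb_iff_rpow_le one_lt_two (by positivity)] at hupper
    refine hupper.trans ?_
    have := logb_le_graphEntropy (G := G) isProbDist_uniform (div_pos hα hn) fun a ha => by
      rw [← mul_sum, one_div_mul_eq_div]
      exact div_le_div_of_nonneg_right (sum_le_indepNum ha) hn.le
    rwa [one_div_div] at this
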